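/- The partial volume over the zone Ω₁ is ∫∫_{Ω₁} 1/(a(a+b)) da db = −(ln φ)² − ∫_{φ̄²}^{φ̄} (ln(1−t)/t) dt, i.e., it equals −(ln φ)² + Li₂(φ̄) − Li₂(φ̄²) where Li₂ denotes the dilogarithm. -/

import Mathlib

open Matrix MeasureTheory Filter Topology

noncomputable section

abbrev SL2 := Matrix.SpecialLinearGroup (Fin 2) ℝ

/-- The golden ratio φ = (1+√5)/2. -/
def phi : ℝ := (1 + Real.sqrt 5) / 2

/-- φ̄ = 1/φ. -/
def phib : ℝ := phi⁻¹

/-- S = [[0,−1],[1,0]]. -/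
def Smat : SL2 := ⟨!![0, -1; 1, 0], by norm_num [Matrix.det_fin_two_of]⟩

/-- P = [[1,φ],[0,1]]. -/
def Pmat : SL2 := ⟨!![1, phi; 0, 1], by norm_num [Matrix.det_fin_two_of]⟩

/-- The Veech group of the golden L: the subgroup generated by S and P. -/
def Γ : Subgroup SL2 := Subgroup.closure {Smat, Pmat}

/-- Linear action of a 2×2 matrix on ℝ². -/
def mact (g : Matrix (Fin 2) (Fin 2) ℝ) (v : ℝ × ℝ) : ℝ × ℝ :=
  (g 0 0 * v.1 + g 0 1 * v.2, g 1 0 * v.1 + g 1 1 * v.2)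

/-- Λ = Γ·(1,0)ᵀ. -/
def Λ : Set (ℝ × ℝ) := {v | ∃ γ ∈ Γ, v = mact (γ : Matrix (Fin 2) (Fin 2) ℝ) (1, 0)}

/-- g_{a,b} = [[a,b],[0,1/a]]. -/
def gab (a b : ℝ) : Matrix (Fin 2) (Fin 2) ℝ := !![a, b; 0, a⁻¹]

/-- h_s = [[1,0],[−s,1]]. -/
def hmat (s : ℝ) : Matrix (Fin 2) (Fin 2) ℝ := !![1, 0; -s, 1]

/-- Ω = {(a,b) : 0 < a ≤ 1, 1 − aφ < b ≤ 1}. -/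
def Ω : Set (ℝ × ℝ) := {p | 0 < p.1 ∧ p.1 ≤ 1 ∧ 1 - p.1 * phi < p.2 ∧ p.2 ≤ 1}

/-- Ω₁ = {(a,b) ∈ Ω : φ̄ ≤ a ≤ 1, 1 − aφ < b ≤ φ̄ − a}. -/
def Ω₁ : Set (ℝ × ℝ) :=
  {p | p ∈ Ω ∧ phib ≤ p.1 ∧ p.1 ≤ 1 ∧ 1 - p.1 * phi < p.2 ∧ p.2 ≤ phib - p.1}

/-- Ω_φ = {(a,b) ∈ Ω : φ̄² ≤ a ≤ 1, φ̄ − a < b ≤ φ̄ − aφ̄}. -/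
def Ωphi : Set (ℝ × ℝ) :=
  {p | p ∈ Ω ∧ phib ^ 2 ≤ p.1 ∧ p.1 ≤ 1 ∧ phib - p.1 < p.2 ∧ p.2 ≤ phib - p.1 * phib}

/-- Ω_∞ = {(a,b) ∈ Ω : φ̄ − aφ̄ < b ≤ 1}. -/
def Ωinf : Set (ℝ × ℝ) := {p | p ∈ Ω ∧ phib - p.1 * phib < p.2 ∧ p.2 ≤ 1}

-- The return time function R.
open Classical in
noncomputable def Rfun (p : ℝ × ℝ) : ℝ :=
  if p ∈ Ω₁ then 1 / (p.1 * (p.1 + p.2))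
  else if p ∈ Ωphi then 1 / (p.1 * (p.1 * phib + p.2))
  else 1 / (p.1 * p.2)

/-- The probability measure m with dm = (2/φ) da db on Ω. -/
noncomputable def m : Measure (ℝ × ℝ) := ENNReal.ofReal (2 / phi) • volume.restrict Ω

-- The golden-L BCZ map T.
open Classical in
noncomputable def Tmap (p : ℝ × ℝ) : ℝ × ℝ :=
  if p ∈ Ω₁ then
    ((p.1 + p.2) * phi,
      p.1 + p.2 * phi +
        (-(⌊(p.1 + p.2 * phi - 1) / (phi ^ 2 * (p.1 + p.2))⌋ : ℤ) : ℝ) * phi ^ 2 * (p.1 + p.2))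
  else if p ∈ Ωphi then
    (p.1 + p.2 * phi,
      p.2 + (-(⌊(p.2 - 1) / (phi * (p.1 + p.2 * phi))⌋ : ℤ) : ℝ) * phi * (p.1 + p.2 * phi))
  else
    (p.2, -p.1 + (-(⌊(-p.1 - 1) / (phi * p.2)⌋ : ℤ) : ℝ) * phi * p.2)

/-- The dilogarithm Li₂(x) = −∫₀ˣ ln(1−t)/t dt. -/
def Li2 (x : ℝ) : ℝ := -∫ t in (0:ℝ)..x, Real.log (1 - t) / t

/-- The zone Ω₁ = {(a,b) : φ̄ ≤ a ≤ 1, 1 − aφ < b ≤ φ̄ − a}. -/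
def Ω₁' : Set (ℝ × ℝ) :=
  {p | phib ≤ p.1 ∧ p.1 ≤ 1 ∧ 1 - p.1 * phi < p.2 ∧ p.2 ≤ phib - p.1}

theorem setIntegral_between {s : Set ℝ} (hs : MeasurableSet s) {f g : ℝ → ℝ} {F : ℝ × ℝ → ℝ}
    (hm : MeasurableSet {p : ℝ × ℝ | p.1 ∈ s ∧ f p.1 < p.2 ∧ p.2 ≤ g p.1})
    (hF : IntegrableOn F {p : ℝ × ℝ | p.1 ∈ s ∧ f p.1 < p.2 ∧ p.2 ≤ g p.1}) :
    ∫ p in {p : ℝ × ℝ | p.1 ∈ s ∧ f p.1 < p.2 ∧ p.2 ≤ g p.1}, F p =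
      ∫ a in s, ∫ b in Set.Ioc (f a) (g a), F (a, b) := by
  classical
  rw [← integral_indicator hm, Measure.volume_eq_prod,
    integral_prod _ (by rwa [← Measure.volume_eq_prod, integrable_indicator_iff hm]),
    ← integral_indicator hs]
  congr 1 with a
  by_cases ha : a ∈ s
  · rw [Set.indicator_of_mem ha, ← integral_indicator measurableSet_Ioc]
    congr 1 with b
    simp [Set.indicator_apply, ha]
  · simp [ha]

theorem phi_pos : 0 < phi := by unfold phi; positivity

theorem phib_pos : 0 < phib := inv_pos.2 phi_pos

theorem phi_sq : phi ^ 2 = phi + 1 := Real.goldenRatio_sq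

theorem phi_eq : phi = 1 + phib := by
  have h := phi_sq
  have := phi_pos.ne'
  unfold phib
  field_simp
  linarith

theorem phib_sq : phib ^ 2 = 1 - phib := by
  have h : phi * phib = 1 := mul_inv_cancel₀ phi_pos.ne'
  rw [phi_eq] at h
  linarith

theorem phib_lt_one : phib < 1 := by nlinarith [phib_sq, phib_pos]

theorem intervalIntegrable_log_one_sub_div {x : ℝ} (hx0 : 0 ≤ x) (hx1 : x < 1) :
    IntervalIntegrable (fun t : ℝ => Real.log (1 - t) / t) volume 0 x := by
  rw [intervalIntegrable_iff_integrableOn_Ioc_of_le hx0]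
  refine Measure.integrableOn_of_bounded (M := 1 / (1 - x)) (by simp)
    (by fun_prop : Measurable fun t : ℝ => Real.log (1 - t) / t).aestronglyMeasurable ?_
  refine (ae_restrict_iff' measurableSet_Ioc).2 (ae_of_all _ fun t ht => ?_)
  have h1 : 0 < 1 - t := by linarith [ht.2]
  have h2 := Real.one_sub_inv_le_log_of_pos h1
  have h3 : Real.log (1 - t) ≤ 0 := Real.log_nonpos h1.le (by linarith [ht.1])
  rw [Real.norm_eq_abs, abs_div, abs_of_nonpos h3, abs_of_pos ht.1, div_le_iff₀ ht.1]
  have h4 : (1 - t)⁻¹ - 1 = 1 / (1 - t) * t := by field_simp; ring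
  have h5 : 1 / (1 - t) * t ≤ 1 / (1 - x) * t := by
    have := ht.1.le
    have := ht.2
    have : 0 < 1 - x := by linarith
    gcongr
  linarith

theorem one_sub_phi_mul_add_self (a : ℝ) : 1 - a * phi + a = 1 - phib * a := by
  rw [phi_eq]; ring

theorem measurableSet_Ω₁' : MeasurableSet Ω₁' := by
  unfold Ω₁'
  measurability

theorem integrableOn_Ω₁' :
    IntegrableOn (fun p : ℝ × ℝ => 1 / (p.1 * (p.1 + p.2))) Ω₁' := by
  have hsub : Ω₁' ⊆ Set.Icc (0 : ℝ) 1 ×ˢ Set.Icc (-phi) 1 := by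
    rintro ⟨a, b⟩ ⟨h1, h2, h3, h4⟩
    have := phib_pos
    have := phi_pos
    have := phib_lt_one
    simp only at h1 h2 h3 h4
    refine ⟨⟨by simp only; linarith, h2⟩, ?_, ?_⟩ <;> simp only <;> nlinarith
  refine Measure.integrableOn_of_bounded (M := 1 / (phib * phib ^ 2))
    (((measure_mono hsub).trans_lt
      (isCompact_Icc.prod isCompact_Icc).measure_lt_top).ne)
    (by fun_prop : Measurable fun p : ℝ × ℝ => 1 / (p.1 * (p.1 + p.2))).aestronglyMeasurable ?_
  refine (ae_restrict_iff' measurableSet_Ω₁').2 (ae_of_all _ ?_)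
  rintro ⟨a, b⟩ ⟨h1, h2, h3, -⟩
  simp only at h1 h2 h3 ⊢
  have h0 := phib_pos
  have ha : 0 < a := h0.trans_le h1
  have hab : phib ^ 2 ≤ a + b := by
    nlinarith [phib_sq, one_sub_phi_mul_add_self a]
  have hab' : 0 < a + b := (pow_pos h0 2).trans_le hab
  rw [Real.norm_of_nonneg (by positivity)]
  gcongr

theorem integral_fiber_Ω₁' {a : ℝ} (ha : a ∈ Set.Icc phib 1) :
    ∫ b in Set.Ioc (1 - a * phi) (phib - a), 1 / (a * (a + b)) =
      Real.log phib * a⁻¹ - phib * (Real.log (1 - phib * a) / (phib * a)) := by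
  have h0 := phib_pos
  have h1 := phib_lt_one
  have ha0 : 0 < a := h0.trans_le ha.1
  have hlow : 0 < 1 - phib * a := by nlinarith [ha.2]
  have hle : 1 - a * phi ≤ phib - a := by
    nlinarith [ha.1, phib_sq, one_sub_phi_mul_add_self a]
  rw [← intervalIntegral.integral_of_le hle]
  simp_rw [one_div, mul_inv]
  rw [intervalIntegral.integral_const_mul,
    intervalIntegral.integral_comp_add_left (fun x => x⁻¹) a,
    add_comm a (1 - a * phi), one_sub_phi_mul_add_self, add_sub_cancel,
    integral_inv_of_pos hlow h0, Real.log_div h0.ne' hlow.ne']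
  field_simp

theorem integral_Ω₁' :
    ∫ p in Ω₁', 1 / (p.1 * (p.1 + p.2)) =
      -(Real.log phi) ^ 2 - ∫ t in (phib ^ 2)..phib, Real.log (1 - t) / t := by
  have h0 := phib_pos
  have h1 := phib_lt_one
  have hset : Ω₁' = {p : ℝ × ℝ | p.1 ∈ Set.Icc phib 1 ∧ 1 - p.1 * phi < p.2 ∧
      p.2 ≤ phib - p.1} := by
    ext p; simp [Ω₁', and_assoc]
  have hm := measurableSet_Ω₁'
  have hi := integrableOn_Ω₁'
  rw [hset] at hm hi ⊢
  rw [setIntegral_between (f := fun a => 1 - a * phi) (g := fun a => phib - a)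
      measurableSet_Icc hm hi,
    setIntegral_congr_fun measurableSet_Icc fun a ha => integral_fiber_Ω₁' ha,
    integral_Icc_eq_integral_Ioc, ← intervalIntegral.integral_of_le h1.le]
  have hpos : ∀ a ∈ Set.uIcc phib 1, 0 < a ∧ 0 < 1 - phib * a := fun a ha => by
    rw [Set.uIcc_of_le h1.le] at ha
    exact ⟨h0.trans_le ha.1, by nlinarith [ha.2]⟩
  rw [intervalIntegral.integral_sub, intervalIntegral.integral_const_mul,
    intervalIntegral.integral_const_mul, integral_inv_of_pos h0 one_pos,
    intervalIntegral.mul_integral_comp_mul_left (f := fun t => Real.log (1 - t) / t),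
    mul_one, ← sq, one_div, Real.log_inv, phib, Real.log_inv]
  · ring
  · refine ContinuousOn.intervalIntegrable (continuousOn_const.mul ?_)
    exact continuousOn_id.inv₀ fun a ha => (hpos a ha).1.ne'
  · refine ContinuousOn.intervalIntegrable (continuousOn_const.mul (ContinuousOn.div ?_ ?_ ?_))
    · exact ContinuousOn.log (by fun_prop) fun a ha => (hpos a ha).2.ne'
    · fun_prop
    · exact fun a ha => (mul_pos h0 (hpos a ha).1).ne'

/-- The partial volume over Ω₁:
∫∫_{Ω₁} 1/(a(a+b)) da db = −(ln φ)² − ∫_{φ̄²}^{φ̄} ln(1−t)/t dt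
= −(ln φ)² + Li₂(φ̄) − Li₂(φ̄²). -/
theorem partial_volume_Omega_one :
    (∫ p in Ω₁', 1 / (p.1 * (p.1 + p.2))) =
        -(Real.log phi) ^ 2 - ∫ t in (phib ^ 2)..phib, Real.log (1 - t) / t ∧
    (∫ p in Ω₁', 1 / (p.1 * (p.1 + p.2))) =
        -(Real.log phi) ^ 2 + Li2 phib - Li2 (phib ^ 2) := by
  have h0 := phib_pos
  have h1 := phib_lt_one
  refine ⟨integral_Ω₁', ?_⟩
  have hsub := intervalIntegral.integral_interval_sub_left
    (intervalIntegrable_log_one_sub_div h0.le h1)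
    (intervalIntegrable_log_one_sub_div (sq_nonneg phib) (by nlinarith))
  rw [integral_Ω₁', Li2, Li2, ← hsub]
  ring
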